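/- arXiv:1608.08169 — 6 statements merged into one kernel-verified Lean document; each statement's English description precedes it below -/
import Mathlib

section
/- Let s ≥ 0, t ≥ 0, and let h : ℝ → ℂ be measurable with ∫_{|ξ|≤√2} |h(ξ)|² dξ < ∞. Then (∫_{0<|ξ|≤√2, ξ²<2} |ξ|^{2s} · (sinh(|ξ|·√(2 − ξ²)·t) / (|ξ|·√(2 − ξ²)))² · ξ⁴ · |h(ξ)|² dξ)^{1/2} ≤ 2^{s/2 + 1} · sinh(t) · (∫_{|ξ|≤√2} |h(ξ)|² dξ)^{1/2}. -/
open MeasureTheory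

theorem Real.convexOn_sinh_Ici : ConvexOn ℝ (Set.Ici 0) Real.sinh := by
  refine convexOn_of_deriv2_nonneg (convex_Ici 0) Real.continuous_sinh.continuousOn
    Real.differentiable_sinh.differentiableOn ?_ ?_
  · rw [Real.deriv_sinh]
    exact Real.differentiable_cosh.differentiableOn
  · intro x hx
    rw [interior_Ici] at hx
    simpa [Real.deriv_sinh, Real.deriv_cosh] using le_of_lt hx

theorem Real.sinh_mul_le_mul_sinh {a t : ℝ} (ha : 0 ≤ a) (ha1 : a ≤ 1) (ht : 0 ≤ t) :
    Real.sinh (a * t) ≤ a * Real.sinh t := by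
  have := Real.convexOn_sinh_Ici.2 (Set.mem_Ici.2 ht) (Set.mem_Ici.2 le_rfl) ha
    (sub_nonneg.2 ha1) (by ring)
  simpa using this

/-- The squared multiplier is bounded by `2 ^ s * (2 * sinh t) ^ 2` at unstable frequencies. -/
theorem sinh_symbol_sq_le {s t ξ : ℝ} (hs : 0 ≤ s) (ht : 0 ≤ t) (h0 : 0 < |ξ|)
    (h2 : ξ ^ 2 < 2) :
    |ξ| ^ (2 * s) *
        (Real.sinh (|ξ| * Real.sqrt (2 - ξ ^ 2) * t) / (|ξ| * Real.sqrt (2 - ξ ^ 2))) ^ 2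
        * ξ ^ 4 ≤ (2 ^ (s / 2 + 1) * Real.sinh t) ^ 2 := by
  have hr : 0 < Real.sqrt (2 - ξ ^ 2) := Real.sqrt_pos.2 (by linarith)
  have ha : 0 < |ξ| * Real.sqrt (2 - ξ ^ 2) := mul_pos h0 hr
  have ha1 : |ξ| * Real.sqrt (2 - ξ ^ 2) ≤ 1 := by
    nlinarith [sq_nonneg (|ξ| - Real.sqrt (2 - ξ ^ 2)), sq_abs ξ,
      Real.sq_sqrt (show (0 : ℝ) ≤ 2 - ξ ^ 2 by linarith)]
  have hq : Real.sinh (|ξ| * Real.sqrt (2 - ξ ^ 2) * t) / (|ξ| * Real.sqrt (2 - ξ ^ 2))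
      ≤ Real.sinh t := by
    rw [div_le_iff₀ ha, mul_comm (Real.sinh t)]
    exact Real.sinh_mul_le_mul_sinh ha.le ha1 ht
  have hq0 : 0 ≤ Real.sinh (|ξ| * Real.sqrt (2 - ξ ^ 2) * t) / (|ξ| * Real.sqrt (2 - ξ ^ 2)) :=
    div_nonneg (Real.sinh_nonneg_iff.2 (by positivity)) ha.le
  have hp : |ξ| ^ (2 * s) ≤ 2 ^ s := by
    rw [Real.rpow_mul h0.le, Real.rpow_two, sq_abs]
    exact Real.rpow_le_rpow (sq_nonneg ξ) h2.le hs
  have h4 : ξ ^ 4 ≤ 4 := by nlinarith [sq_nonneg ξ]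
  have hc : ((2 : ℝ) ^ (s / 2 + 1)) ^ 2 = 2 ^ s * 4 := by
    rw [← Real.rpow_mul_natCast zero_le_two, show (s / 2 + 1) * ((2 : ℕ) : ℝ) = s + 2 by
      push_cast; ring, Real.rpow_add two_pos]
    norm_num
  calc _ ≤ 2 ^ s * Real.sinh t ^ 2 * 4 := by gcongr
    _ = _ := by rw [mul_pow, hc]; ring

theorem sinh_symbol_energy_estimate (s t : ℝ) (hs : 0 ≤ s) (ht : 0 ≤ t)
    (h : ℝ → ℂ) (hm : Measurable h)
    (hint : IntegrableOn (fun ξ : ℝ => ‖h ξ‖ ^ 2) {ξ : ℝ | |ξ| ≤ Real.sqrt 2}) :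
    Real.sqrt (∫ ξ in {ξ : ℝ | 0 < |ξ| ∧ |ξ| ≤ Real.sqrt 2 ∧ ξ ^ 2 < 2},
        |ξ| ^ (2 * s) *
          (Real.sinh (|ξ| * Real.sqrt (2 - ξ ^ 2) * t) / (|ξ| * Real.sqrt (2 - ξ ^ 2))) ^ 2
          * ξ ^ 4 * ‖h ξ‖ ^ 2)
      ≤ 2 ^ (s / 2 + 1) * Real.sinh t *
        Real.sqrt (∫ ξ in {ξ : ℝ | |ξ| ≤ Real.sqrt 2}, ‖h ξ‖ ^ 2) := by
  have hsinh : 0 ≤ Real.sinh t := Real.sinh_nonneg_iff.2 ht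
  have hC : 0 ≤ 2 ^ (s / 2 + 1) * Real.sinh t := by positivity
  have hsub : {ξ : ℝ | 0 < |ξ| ∧ |ξ| ≤ Real.sqrt 2 ∧ ξ ^ 2 < 2} ⊆ {ξ : ℝ | |ξ| ≤ Real.sqrt 2} :=
    fun ξ hξ => hξ.2.1
  have hmeas : MeasurableSet {ξ : ℝ | 0 < |ξ| ∧ |ξ| ≤ Real.sqrt 2 ∧ ξ ^ 2 < 2} := by
    measurability
  rw [← Real.sqrt_sq hC, ← Real.sqrt_mul (sq_nonneg _)]
  refine Real.sqrt_le_sqrt ?_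
  calc _ ≤ ∫ ξ in {ξ : ℝ | 0 < |ξ| ∧ |ξ| ≤ Real.sqrt 2 ∧ ξ ^ 2 < 2},
        (2 ^ (s / 2 + 1) * Real.sinh t) ^ 2 * ‖h ξ‖ ^ 2 := by
        refine integral_mono_of_nonneg (.of_forall fun ξ => by positivity)
          ((hint.mono_set hsub).const_mul _) ?_
        filter_upwards [ae_restrict_mem hmeas] with ξ hξ
        exact mul_le_mul_of_nonneg_right (sinh_symbol_sq_le hs ht hξ.1 hξ.2.2) (by positivity)
    _ = (2 ^ (s / 2 + 1) * Real.sinh t) ^ 2 *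
        ∫ ξ in {ξ : ℝ | 0 < |ξ| ∧ |ξ| ≤ Real.sqrt 2 ∧ ξ ^ 2 < 2}, ‖h ξ‖ ^ 2 :=
        integral_const_mul _ _
    _ ≤ _ := by
        refine mul_le_mul_of_nonneg_left ?_ (sq_nonneg _)
        exact setIntegral_mono_set hint (.of_forall fun ξ => by positivity) hsub.eventuallyLE
end

section
/- Let s ≥ 0, t ≥ 0, and let h : ℝ → ℂ be measurable with ∫_{|ξ|>√2} |ξ|^{2s} |h(ξ)|² dξ < ∞. Then (∫_{|ξ|>√2} |ξ|^{2s} · (sin(|ξ|·√(ξ² − 2)·t) / (|ξ|·√(ξ² − 2)))² · ξ⁴ · |h(ξ)|² dξ)^{1/2} ≤ 4 · max{1, t} · (∫_{|ξ|>√2} |ξ|^{2s} |h(ξ)|² dξ)^{1/2}. -/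
open MeasureTheory

lemma sq_sin_mul_div_le (θ t : ℝ) : (Real.sin (θ * t) / θ) ^ 2 ≤ t ^ 2 := by
  rcases eq_or_ne θ 0 with rfl | hθ
  · simpa using sq_nonneg t
  · rw [div_pow, div_le_iff₀ (by positivity)]
    have := sq_le_sq.mpr (Real.abs_sin_le_abs (x := θ * t))
    linarith [mul_pow θ t 2, mul_comm (θ ^ 2) (t ^ 2)]

lemma sq_sin_symbol_mul_le {ξ t : ℝ} (ht : 0 ≤ t) (hξ : Real.sqrt 2 < |ξ|) :
    (Real.sin (|ξ| * Real.sqrt (ξ ^ 2 - 2) * t) / (|ξ| * Real.sqrt (ξ ^ 2 - 2))) ^ 2 * ξ ^ 4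
      ≤ (4 * max 1 t) ^ 2 := by
  have h2 : 2 < ξ ^ 2 := by
    rw [← sq_abs]
    exact (Real.sqrt_lt' (lt_of_le_of_lt (Real.sqrt_nonneg 2) hξ)).mp hξ
  have hM : 1 ≤ (max 1 t) ^ 2 := one_le_pow₀ (le_max_left 1 t)
  have htM : t ^ 2 ≤ (max 1 t) ^ 2 := pow_le_pow_left₀ ht (le_max_right 1 t) 2
  rw [mul_pow]
  rcases lt_or_ge (ξ ^ 2) 4 with h4 | h4
  · have hξ4 : ξ ^ 4 ≤ 4 ^ 2 := by nlinarith
    calc _ ≤ t ^ 2 * 4 ^ 2 :=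
          mul_le_mul (sq_sin_mul_div_le _ t) hξ4 (by positivity) (sq_nonneg t)
      _ ≤ _ := by linarith
  · have hθ : (|ξ| * Real.sqrt (ξ ^ 2 - 2)) ^ 2 = ξ ^ 2 * (ξ ^ 2 - 2) := by
      rw [mul_pow, sq_abs, Real.sq_sqrt (by linarith)]
    have hpos : 0 < ξ ^ 2 * (ξ ^ 2 - 2) := mul_pos (by linarith) (by linarith)
    calc _ ≤ 1 / (ξ ^ 2 * (ξ ^ 2 - 2)) * ξ ^ 4 := by
          rw [div_pow, hθ]
          gcongr
          exact Real.sin_sq_le_one _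
      _ ≤ 2 := by
          rw [one_div_mul_eq_div, div_le_iff₀ hpos]
          nlinarith
      _ ≤ _ := by linarith

theorem sin_symbol_energy_estimate (s t : ℝ) (hs : 0 ≤ s) (ht : 0 ≤ t)
    (h : ℝ → ℂ) (hm : Measurable h)
    (hint : IntegrableOn (fun ξ : ℝ => |ξ| ^ (2 * s) * ‖h ξ‖ ^ 2)
      {ξ : ℝ | Real.sqrt 2 < |ξ|}) :
    Real.sqrt (∫ ξ in {ξ : ℝ | Real.sqrt 2 < |ξ|},
        |ξ| ^ (2 * s) *
          (Real.sin (|ξ| * Real.sqrt (ξ ^ 2 - 2) * t) / (|ξ| * Real.sqrt (ξ ^ 2 - 2))) ^ 2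
          * ξ ^ 4 * ‖h ξ‖ ^ 2)
      ≤ 4 * max 1 t *
        Real.sqrt (∫ ξ in {ξ : ℝ | Real.sqrt 2 < |ξ|}, |ξ| ^ (2 * s) * ‖h ξ‖ ^ 2) := by
  have hM : 0 ≤ 4 * max 1 t := by positivity
  have hS : MeasurableSet {ξ : ℝ | Real.sqrt 2 < |ξ|} :=
    measurableSet_lt measurable_const measurable_norm
  rw [← Real.sqrt_sq hM, ← Real.sqrt_mul (sq_nonneg _), ← integral_const_mul]
  refine Real.sqrt_le_sqrt (integral_mono_of_nonneg (ae_of_all _ fun ξ => by positivity)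
    (hint.const_mul _) ?_)
  filter_upwards [ae_restrict_mem hS] with ξ hξ
  have key := mul_le_mul_of_nonneg_right (sq_sin_symbol_mul_le ht hξ)
    (show 0 ≤ |ξ| ^ (2 * s) * ‖h ξ‖ ^ 2 by positivity)
  linarith
end

section
/- Let a > 1/2 and set α := √(8a(2a − 1)) and β := √(2(2a − 1)). Then for all (t, x) ∈ ℝ × ℝ the denominator α·cosh(βx) − √2·β·cos(αt) is strictly positive, and the function B : ℝ × ℝ → ℂ defined by B(t, x) := e^{it} · [1 − √2·β·(β²·cos(αt) + i·α·sin(αt)) / (α·cosh(βx) − √2·β·cos(αt))] is a classical solution of the focusing cubic nonlinear Schrödinger equation: for all (t, x), i·∂ₜB(t, x) + ∂ₓ²B(t, x) + |B(t, x)|²·B(t, x) = 0. -/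
theorem kuznetsov_ma_numerator_identity (s c C S α γ β : ℂ)
    (h₁ : s ^ 2 = 1 - c ^ 2) (h₂ : S ^ 2 = C ^ 2 - 1) (hα : α ^ 2 = β ^ 2 * (β ^ 2 + 2))
    (hγ : γ ^ 2 = 2 * β ^ 2) {D N N' Nt Dt : ℂ} (hD : D = α * C - γ * c)
    (hN : N = γ * (β ^ 2 * c + Complex.I * α * s)) (hN' : N' = γ * (β ^ 2 * c - Complex.I * α * s))
    (hNt : Nt = γ * (-(β ^ 2 * α * s) + Complex.I * α ^ 2 * c)) (hDt : Dt = γ * α * s) :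
    Complex.I * (Complex.I * (D - N) * D ^ 2 - (Nt * D - N * Dt) * D) + N * (α * β ^ 2 * C) * D
      - 2 * N * (α * β * S) ^ 2 + (D - N) ^ 2 * (D - N') = 0 := by
  have hI := Complex.I_sq
  generalize Complex.I = i at *
  subst hD hN hN' hNt hDt
  grind

theorem kuznetsov_ma_denominator_pos {α β γ : ℝ} (hγ : 0 ≤ γ) (h : γ < α) (t x : ℝ) :
    0 < α * Real.cosh (β * x) - γ * Real.cos (α * t) := by
  nlinarith [Real.one_le_cosh (β * x), Real.cos_le_one (α * t)]

theorem kuznetsov_ma_solves_NLS (a : ℝ) (ha : 1 / 2 < a)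
    (α β : ℝ)
    (hα : α = Real.sqrt (8 * a * (2 * a - 1)))
    (hβ : β = Real.sqrt (2 * (2 * a - 1)))
    (B : ℝ → ℝ → ℂ)
    (hB : B = fun t x : ℝ =>
      Complex.exp (Complex.I * (t : ℂ)) *
        (1 - (Real.sqrt 2 : ℂ) * (β : ℂ) *
            ((β : ℂ) ^ 2 * (Real.cos (α * t) : ℂ) + Complex.I * (α : ℂ) * (Real.sin (α * t) : ℂ)) /
          ((α : ℂ) * (Real.cosh (β * x) : ℂ) - (Real.sqrt 2 : ℂ) * (β : ℂ) * (Real.cos (α * t) : ℂ)))) :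
    (∀ t x : ℝ, 0 < α * Real.cosh (β * x) - Real.sqrt 2 * β * Real.cos (α * t))
    ∧ ∀ t x : ℝ,
        Complex.I * deriv (fun t' : ℝ => B t' x) t
        + deriv (deriv (fun x' : ℝ => B t x')) x
        + (‖B t x‖ : ℂ) ^ 2 * B t x = 0 := by
  have hβ2 : β ^ 2 = 2 * (2 * a - 1) := by rw [hβ, Real.sq_sqrt (by linarith)]
  have hα2 : α ^ 2 = 8 * a * (2 * a - 1) := by
    rw [hα, Real.sq_sqrt (by nlinarith)]
  have hβ0 : 0 ≤ β := hβ ▸ Real.sqrt_nonneg _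
  have hα0 : 0 ≤ α := hα ▸ Real.sqrt_nonneg _
  have hs2 : Real.sqrt 2 ^ 2 = 2 := Real.sq_sqrt (by norm_num)
  have hγ0 : 0 ≤ Real.sqrt 2 * β := by positivity
  have hγ2 : (Real.sqrt 2 * β) ^ 2 = 2 * β ^ 2 := by rw [mul_pow, hs2]
  have hlt : Real.sqrt 2 * β < α := by
    refine lt_of_pow_lt_pow_left₀ 2 hα0 ?_
    rw [hγ2, hα2, hβ2]
    nlinarith
  have hαβ : α ^ 2 = β ^ 2 * (β ^ 2 + 2) := by rw [hα2, hβ2]; ring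
  have hpos := kuznetsov_ma_denominator_pos (β := β) hγ0 hlt
  refine ⟨hpos, fun t x => ?_⟩
  have hBe : ∀ t x : ℝ, B t x = Complex.exp (Complex.I * t) *
      (1 - ((Real.sqrt 2 * β : ℝ) : ℂ) *
          ((β : ℂ) ^ 2 * (Real.cos (α * t) : ℂ) + Complex.I * α * (Real.sin (α * t) : ℂ)) /
        ((α * Real.cosh (β * x) - Real.sqrt 2 * β * Real.cos (α * t) : ℝ) : ℂ)) := by
    intro t x
    rw [hB]
    push_cast
    rfl
  clear hB
  generalize Real.sqrt 2 * β = γ at *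
  set n : ℝ → ℂ := fun t =>
    (γ : ℂ) * ((β : ℂ) ^ 2 * (Real.cos (α * t) : ℂ) + Complex.I * α * (Real.sin (α * t) : ℂ)) with hn
  set d : ℝ → ℝ → ℝ := fun t x => α * Real.cosh (β * x) - γ * Real.cos (α * t) with hd
  have hd0 : ∀ t x, (d t x : ℂ) ≠ 0 := fun t x => Complex.ofReal_ne_zero.2 (hpos t x).ne'
  have hBe' : ∀ t x, B t x = Complex.exp (Complex.I * t) * (1 - n t / (d t x : ℂ)) := hBe
  have hcos : HasDerivAt (fun t : ℝ => Real.cos (α * t)) (-Real.sin (α * t) * (α * 1)) t :=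
    ((hasDerivAt_id t).const_mul α).cos
  have hsin : HasDerivAt (fun t : ℝ => Real.sin (α * t)) (Real.cos (α * t) * (α * 1)) t :=
    ((hasDerivAt_id t).const_mul α).sin
  have hcosh : ∀ y : ℝ, HasDerivAt (fun x : ℝ => Real.cosh (β * x))
      (Real.sinh (β * y) * (β * 1)) y := fun y => ((hasDerivAt_id y).const_mul β).cosh
  have hsinh : HasDerivAt (fun x : ℝ => Real.sinh (β * x)) (Real.cosh (β * x) * (β * 1)) x :=
    ((hasDerivAt_id x).const_mul β).sinh
  have hnt := ((hcos.ofReal_comp.const_mul ((β : ℂ) ^ 2)).add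
    (hsin.ofReal_comp.const_mul (Complex.I * α))).const_mul (γ : ℂ)
  have hdt := ((hcos.const_mul γ).const_sub (α * Real.cosh (β * x))).ofReal_comp
  have hdx := fun y => (((hcosh y).const_mul α).sub_const (γ * Real.cos (α * t))).ofReal_comp
  have hexp := ((Complex.ofRealCLM.hasDerivAt (x := t)).const_mul Complex.I).cexp
  have hBt := hexp.mul ((hnt.div hdt (hd0 t x)).const_sub 1)
  have hBx := fun y => (((hasDerivAt_const y (n t)).div (hdx y) (hd0 t y)).const_sub 1).const_mul
    (Complex.exp (Complex.I * t))
  have hBxx := ((((hsinh.mul_const (β * 1)).const_mul α).ofReal_comp.const_mul (n t)).div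
    ((hdx x).pow 2) (pow_ne_zero 2 (hd0 t x))).const_mul (Complex.exp (Complex.I * t))
  have hfun : (fun t' : ℝ => B t' x) = _ := funext fun t' => hBe' t' x
  have hfunx : (fun x' : ℝ => B t x') = _ := funext fun x' => hBe' t x'
  have e1 : deriv (fun x' : ℝ => B t x') = fun y => Complex.exp (Complex.I * t) *
      (n t * ((α * (Real.sinh (β * y) * (β * 1)) : ℝ) : ℂ) / (d t y : ℂ) ^ 2) := by
    rw [hfunx]
    funext y
    refine (hBx y).deriv.trans ?_
    simp only [hd]
    ring
  have hnorm : (‖B t x‖ : ℂ) ^ 2 = (1 - n t / (d t x : ℂ)) *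
      (1 - (γ : ℂ) * ((β : ℂ) ^ 2 * (Real.cos (α * t) : ℂ) - Complex.I * α * (Real.sin (α * t) : ℂ))
        / (d t x : ℂ)) := by
    rw [hBe', norm_mul, mul_comm Complex.I, Complex.norm_exp_ofReal_mul_I, one_mul,
      ← Complex.mul_conj']
    simp only [hn, map_sub, map_one, map_div₀, map_mul, map_add, map_pow, Complex.conj_ofReal,
      Complex.conj_I]
    ring
  rw [e1, hnorm, hBe' t x]
  have e2 := hBt.deriv
  have e3 := hBxx.deriv
  have key := kuznetsov_ma_numerator_identity (Real.sin (α * t)) (Real.cos (α * t))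
    (Real.cosh (β * x)) (Real.sinh (β * x)) α γ β
    (by exact_mod_cast Real.sin_sq (α * t)) (by exact_mod_cast Real.sinh_sq (β * x))
    (by exact_mod_cast hαβ) (by exact_mod_cast hγ2) (D := d t x) (by simp only [hd]; push_cast; rfl)
    (N := n t) rfl rfl rfl rfl
  rw [show deriv (fun t' : ℝ => B t' x) t = _ from (congrArg (deriv · t) hfun).trans e2,
    show deriv (fun y => Complex.exp (Complex.I * t) *
      (n t * ((α * (Real.sinh (β * y) * (β * 1)) : ℝ) : ℂ) / (d t y : ℂ) ^ 2)) x = _ from e3]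
  have hdd := hd0 t x
  have hd' : α * Real.cosh (β * x) - γ * Real.cos (α * t) = d t x := rfl
  have hn' : (γ : ℂ) * ((β : ℂ) ^ 2 * (Real.cos (α * t) : ℂ) +
    Complex.I * α * (Real.sin (α * t) : ℂ)) = n t := rfl
  simp only [Pi.div_apply, Pi.add_apply, Pi.pow_apply, Complex.ofRealCLM_apply, hd', hn']
  clear_value n d
  generalize (d t x : ℂ) = D at key hdd ⊢
  generalize n t = N at key ⊢
  push_cast at key ⊢
  generalize Complex.exp (Complex.I * t) = E
  field_simp
  linear_combination E * key
end

section
/- Define Q : ℝ × ℝ → ℂ by Q(t, x) := −4(1 + 2it)/(1 + 4t² + 2x²), so that the Peregrine breather is P(t, x) = e^{it}(1 + Q(t, x)). Then the Peregrine breather converges to the Stokes wave in H¹ as t → +∞: ∫_ℝ |Q(t, x)|² dx → 0 and ∫_ℝ |∂ₓQ(t, x)|² dx → 0 as t → +∞. Moreover, for every t ∈ ℝ one has ∫_ℝ |Q(t, x)|² dx > 0. -/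
open MeasureTheory Filter

/-- Functions of `x` dominated by `C / (1 + 4t² + 2x²)` have integrals tending to `0`. -/
theorem tendsto_integral_zero_of_le_div {f : ℝ → ℝ → ℝ} {C : ℝ} (hC : 0 ≤ C)
    (hf : ∀ t, Continuous (f t)) (hf0 : ∀ t x, 0 ≤ f t x)
    (hfC : ∀ t x, f t x ≤ C / (1 + 4 * t ^ 2 + 2 * x ^ 2)) :
    Tendsto (fun t : ℝ => ∫ x : ℝ, f t x) atTop (nhds 0) := by
  have hlim : ∀ x : ℝ, Tendsto (fun t : ℝ => f t x) atTop (nhds 0) := fun x => by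
    refine squeeze_zero' (g := fun t : ℝ => C / t) (.of_forall fun t => hf0 t x) ?_
      (tendsto_id.const_div_atTop C)
    filter_upwards [eventually_gt_atTop 0] with t ht
    refine (hfC t x).trans ?_
    gcongr
    nlinarith [sq_nonneg (2 * t - 1), sq_nonneg x]
  have h := tendsto_integral_filter_of_dominated_convergence (μ := volume)
    (F := f) (f := fun _ : ℝ => (0 : ℝ)) (fun x : ℝ => C * (1 + x ^ 2)⁻¹)
    (.of_forall fun t => (hf t).aestronglyMeasurable)
    (.of_forall fun t => .of_forall fun x => by
      rw [Real.norm_of_nonneg (hf0 t x)]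
      refine (hfC t x).trans ?_
      rw [← div_eq_mul_inv]
      exact div_le_div_of_nonneg_left hC (by positivity)
        (by nlinarith [sq_nonneg t, sq_nonneg x]))
    (integrable_inv_one_add_sq.const_mul C) (.of_forall hlim)
  simpa using h

/-- The squared modulus of the numerator of `Q`. -/
theorem norm_sq_peregrine_numerator (t : ℝ) :
    ‖-4 * (1 + 2 * Complex.I * (t : ℂ))‖ ^ 2 = 16 * (1 + 4 * t ^ 2) := by
  rw [← Complex.normSq_eq_norm_sq, Complex.normSq_apply]
  simp
  ring

theorem norm_sq_div_peregrine_denominator (t x : ℝ) :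
    ‖-4 * (1 + 2 * Complex.I * (t : ℂ)) / (1 + 4 * (t : ℂ) ^ 2 + 2 * (x : ℂ) ^ 2)‖ ^ 2
      = 16 * (1 + 4 * t ^ 2) / (1 + 4 * t ^ 2 + 2 * x ^ 2) ^ 2 := by
  have h : (1 + 4 * (t : ℂ) ^ 2 + 2 * (x : ℂ) ^ 2) = ((1 + 4 * t ^ 2 + 2 * x ^ 2 : ℝ) : ℂ) := by
    push_cast; rfl
  rw [h, norm_div, div_pow, norm_sq_peregrine_numerator, Complex.norm_real, Real.norm_eq_abs,
    sq_abs]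

theorem norm_sq_deriv_peregrine (t x : ℝ) :
    ‖deriv (fun y : ℝ => -4 * (1 + 2 * Complex.I * (t : ℂ)) /
        (1 + 4 * (t : ℂ) ^ 2 + 2 * (y : ℂ) ^ 2)) x‖ ^ 2
      = 256 * (1 + 4 * t ^ 2) * x ^ 2 / (1 + 4 * t ^ 2 + 2 * x ^ 2) ^ 4 := by
  have hD : (1 + 4 * t ^ 2 + 2 * x ^ 2 : ℝ) ≠ 0 := by positivity
  have hreal : HasDerivAt (fun y : ℝ => (1 + 4 * t ^ 2 + 2 * y ^ 2)⁻¹)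
      (-(4 * x) / (1 + 4 * t ^ 2 + 2 * x ^ 2) ^ 2) x := by
    have h : HasDerivAt (fun y : ℝ => 1 + 4 * t ^ 2 + 2 * y ^ 2) (4 * x) x := by
      refine (((hasDerivAt_pow 2 x).const_mul 2).const_add (1 + 4 * t ^ 2)).congr_deriv ?_
      push_cast
      ring
    exact h.fun_inv hD
  have h := (hreal.ofReal_comp).const_mul (-4 * (1 + 2 * Complex.I * (t : ℂ)))
  have hfun : (fun y : ℝ => -4 * (1 + 2 * Complex.I * (t : ℂ)) /
      (1 + 4 * (t : ℂ) ^ 2 + 2 * (y : ℂ) ^ 2)) = fun y : ℝ =>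
      -4 * (1 + 2 * Complex.I * (t : ℂ)) * (((1 + 4 * t ^ 2 + 2 * y ^ 2)⁻¹ : ℝ) : ℂ) := by
    funext y
    push_cast
    rw [div_eq_mul_inv]
  rw [hfun, h.deriv, norm_mul, mul_pow, norm_sq_peregrine_numerator, Complex.norm_real,
    Real.norm_eq_abs, sq_abs]
  field_simp
  ring

theorem peregrine_converges_to_stokes (Q : ℝ → ℝ → ℂ)
    (hQ : Q = fun t x : ℝ =>
      -4 * (1 + 2 * Complex.I * (t : ℂ)) / (1 + 4 * (t : ℂ) ^ 2 + 2 * (x : ℂ) ^ 2)) :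
    Tendsto (fun t : ℝ => ∫ x : ℝ, ‖Q t x‖ ^ 2) atTop (nhds 0)
    ∧ Tendsto (fun t : ℝ => ∫ x : ℝ, ‖deriv (fun x' : ℝ => Q t x') x‖ ^ 2) atTop (nhds 0)
    ∧ ∀ t : ℝ, 0 < ∫ x : ℝ, ‖Q t x‖ ^ 2 := by
  subst hQ
  simp only [norm_sq_div_peregrine_denominator, norm_sq_deriv_peregrine]
  have hpos : ∀ t x : ℝ, 0 < 1 + 4 * t ^ 2 + 2 * x ^ 2 := fun t x => by positivity
  have hcont : ∀ t : ℝ, Continuous fun x : ℝ =>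
      16 * (1 + 4 * t ^ 2) / (1 + 4 * t ^ 2 + 2 * x ^ 2) ^ 2 := fun t =>
    Continuous.div (by fun_prop) (by fun_prop) fun x => (pow_pos (hpos t x) 2).ne'
  have hle : ∀ t x : ℝ, 16 * (1 + 4 * t ^ 2) / (1 + 4 * t ^ 2 + 2 * x ^ 2) ^ 2
      ≤ 16 / (1 + 4 * t ^ 2 + 2 * x ^ 2) := fun t x => by
    rw [div_le_div_iff₀ (pow_pos (hpos t x) 2) (hpos t x)]
    nlinarith [mul_nonneg (sq_nonneg x) (hpos t x).le]
  refine ⟨?_, ?_, fun t => ?_⟩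
  · exact tendsto_integral_zero_of_le_div (by norm_num) hcont (fun t x => by positivity) hle
  · refine tendsto_integral_zero_of_le_div (C := 128) (by norm_num) (fun t => ?_)
      (fun t x => by positivity) fun t x => ?_
    · exact Continuous.div (by fun_prop) (by fun_prop) fun x => (pow_pos (hpos t x) 4).ne'
    · rw [div_le_div_iff₀ (pow_pos (hpos t x) 4) (hpos t x)]
      have ha : 1 ≤ 1 + 4 * t ^ 2 := by nlinarith [sq_nonneg t]
      have hx : 0 ≤ x ^ 2 := sq_nonneg x
      generalize 1 + 4 * t ^ 2 = a at ha ⊢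
      generalize x ^ 2 = y at hx ⊢
      have h1 : 2 * (a * y) ≤ (a + 2 * y) ^ 2 := by nlinarith
      have h2 : (a + 2 * y) ≤ (a + 2 * y) ^ 2 := by nlinarith
      calc 256 * a * y * (a + 2 * y) = 128 * ((2 * (a * y)) * (a + 2 * y)) := by ring
        _ ≤ 128 * ((a + 2 * y) ^ 2 * (a + 2 * y) ^ 2) := by gcongr
        _ = 128 * (a + 2 * y) ^ 4 := by ring
  · refine integral_pos_of_integrable_nonneg_nonzero (x := 0) (hcont t) ?_
      (fun x => by positivity) (by positivity)
    refine (integrable_inv_one_add_sq.const_mul 16).mono' (hcont t).aestronglyMeasurable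
      (.of_forall fun x => ?_)
    rw [Real.norm_of_nonneg (by positivity), ← div_eq_mul_inv]
    refine (hle t x).trans ?_
    exact div_le_div_of_nonneg_left (by norm_num) (by positivity)
      (by nlinarith [sq_nonneg t, sq_nonneg x])
end

section
/- Let P(t, x) := e^{it}·(1 − 4(1 + 2it)/(1 + 4t² + 2x²)) be the Peregrine breather. Then for every t ∈ ℝ, the mass M[P](t) := ∫_ℝ (|P(t, x)|² − 1) dx and the energy E[P](t) := (1/2)∫_ℝ |∂ₓP(t, x)|² dx − (1/4)∫_ℝ (|P(t, x)|² − 1)² dx are both equal to zero: M[P](t) = 0 and E[P](t) = 0. -/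
open MeasureTheory

/-- A continuous function on `ℝ` of size `O(1 / (1 + x ^ 2))` is integrable. -/
lemma integrable_of_abs_le_div_one_add_sq {f : ℝ → ℝ} (hf : Continuous f) (C : ℝ)
    (h : ∀ x, |f x| ≤ C / (1 + x ^ 2)) : Integrable f := by
  refine (integrable_inv_one_add_sq.const_mul C).mono' hf.aestronglyMeasurable
    (Filter.Eventually.of_forall fun x => ?_)
  rw [Real.norm_eq_abs, ← div_eq_mul_inv]
  exact h x

/-- An integrable derivative of a function of size `O(1 / |x|)` has zero integral. -/
lemma integral_eq_zero_of_hasDerivAt_of_abs_le {F f : ℝ → ℝ} (hF : ∀ x, HasDerivAt F (f x) x)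
    (hf : Integrable f) (C : ℝ) (h : ∀ x, |F x| ≤ C * |x⁻¹|) : ∫ x, f x = 0 := by
  have key : ∀ l : Filter ℝ, Filter.Tendsto (fun x : ℝ => x⁻¹) l (nhds 0) →
      Filter.Tendsto F l (nhds 0) := fun l hl => by
    refine squeeze_zero_norm h ?_
    simpa using hl.abs.const_mul C
  simpa using integral_of_hasDerivAt_of_tendsto hF hf (key _ tendsto_inv_atBot_zero)
    (key _ tendsto_inv_atTop_zero)

lemma abs_div_add_two_mul_sq_le {A : ℝ} (hA : 1 ≤ A) (x : ℝ) :
    |x| / (A + 2 * x ^ 2) ≤ |x⁻¹| := by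
  rcases eq_or_ne x 0 with rfl | hx
  · simp
  · have hx' : 0 < |x| := abs_pos.mpr hx
    rw [abs_inv, div_le_iff₀ (by positivity), inv_mul_eq_div, le_div_iff₀ hx', abs_mul_abs_self]
    nlinarith [sq_nonneg x]

lemma abs_peregrine_mass_density_le {A : ℝ} (hA : 1 ≤ A) (x : ℝ) :
    |8 * (A - 2 * x ^ 2) / (A + 2 * x ^ 2) ^ 2| ≤ 8 / (1 + x ^ 2) := by
  have hD : 0 < A + 2 * x ^ 2 := by positivity
  have hN : |A - 2 * x ^ 2| ≤ A + 2 * x ^ 2 := by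
    rw [abs_le]; constructor <;> nlinarith [sq_nonneg x]
  calc |8 * (A - 2 * x ^ 2) / (A + 2 * x ^ 2) ^ 2|
      = 8 * |A - 2 * x ^ 2| / (A + 2 * x ^ 2) ^ 2 := by
        rw [abs_div, abs_mul, abs_of_pos (pow_pos hD 2), abs_of_pos (by norm_num : (0 : ℝ) < 8)]
    _ ≤ 8 * (A + 2 * x ^ 2) / (A + 2 * x ^ 2) ^ 2 := by gcongr
    _ = 8 / (A + 2 * x ^ 2) := by field_simp
    _ ≤ 8 / (1 + x ^ 2) := by gcongr; nlinarith [sq_nonneg x]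

lemma integrable_peregrine_mass_density {A : ℝ} (hA : 1 ≤ A) :
    Integrable fun x : ℝ => 8 * (A - 2 * x ^ 2) / (A + 2 * x ^ 2) ^ 2 := by
  refine integrable_of_abs_le_div_one_add_sq ?_ 8 (abs_peregrine_mass_density_le hA)
  exact Continuous.div (by fun_prop) (by fun_prop) fun x => by positivity

lemma integrable_peregrine_mass_density_sq {A : ℝ} (hA : 1 ≤ A) :
    Integrable fun x : ℝ => (8 * (A - 2 * x ^ 2) / (A + 2 * x ^ 2) ^ 2) ^ 2 := by
  refine integrable_of_abs_le_div_one_add_sq ?_ 64 fun x => ?_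
  · exact (Continuous.div (by fun_prop) (by fun_prop) fun x => by positivity).pow 2
  · rw [abs_pow]
    calc _ ≤ (8 / (1 + x ^ 2)) ^ 2 := by gcongr; exact abs_peregrine_mass_density_le hA x
      _ = 64 / (1 + x ^ 2) ^ 2 := by rw [div_pow]; norm_num
      _ ≤ 64 / (1 + x ^ 2) := by
        gcongr
        exact le_self_pow₀ (by nlinarith [sq_nonneg x]) two_ne_zero

lemma integrable_peregrine_kinetic_density {A : ℝ} (hA : 1 ≤ A) :
    Integrable fun x : ℝ => 256 * A * x ^ 2 / (A + 2 * x ^ 2) ^ 4 := by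
  refine integrable_of_abs_le_div_one_add_sq ?_ 256 fun x => ?_
  · exact Continuous.div (by fun_prop) (by fun_prop) fun x => by positivity
  · have hD : 1 ≤ A + 2 * x ^ 2 := by nlinarith [sq_nonneg x]
    have hD0 : 0 < A + 2 * x ^ 2 := by positivity
    rw [abs_of_nonneg (by positivity)]
    calc 256 * A * x ^ 2 / (A + 2 * x ^ 2) ^ 4
        ≤ 256 * (A + 2 * x ^ 2) * (A + 2 * x ^ 2) / (A + 2 * x ^ 2) ^ 4 := by
          gcongr <;> nlinarith [sq_nonneg x]
      _ = 256 / (A + 2 * x ^ 2) ^ 2 := by field_simp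
      _ ≤ 256 / (A + 2 * x ^ 2) := by
        gcongr
        exact le_self_pow₀ hD two_ne_zero
      _ ≤ 256 / (1 + x ^ 2) := by gcongr; nlinarith [sq_nonneg x]

lemma hasDerivAt_add_two_mul_sq (A x : ℝ) :
    HasDerivAt (fun x : ℝ => A + 2 * x ^ 2) (4 * x) x := by
  refine (((hasDerivAt_pow 2 x).const_mul 2).const_add A).congr_deriv ?_
  norm_num
  ring

lemma integral_peregrine_mass_density {A : ℝ} (hA : 1 ≤ A) :
    ∫ x : ℝ, 8 * (A - 2 * x ^ 2) / (A + 2 * x ^ 2) ^ 2 = 0 := by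
  refine integral_eq_zero_of_hasDerivAt_of_abs_le (F := fun x => 8 * x / (A + 2 * x ^ 2))
    (fun x => ?_) (integrable_peregrine_mass_density hA) 8 fun x => ?_
  · have hD : A + 2 * x ^ 2 ≠ 0 := by positivity
    refine (((hasDerivAt_id' x).const_mul 8).div
      (hasDerivAt_add_two_mul_sq A x) hD).congr_deriv ?_
    ring
  · have hD : 0 < A + 2 * x ^ 2 := by positivity
    rw [abs_div, abs_mul, abs_of_pos hD, abs_of_pos (by norm_num : (0 : ℝ) < 8), mul_div_assoc]
    gcongr
    exact abs_div_add_two_mul_sq_le hA x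

lemma integral_peregrine_energy_density {A : ℝ} (hA : 1 ≤ A) :
    ∫ x : ℝ, ((1 / 2) * (256 * A * x ^ 2 / (A + 2 * x ^ 2) ^ 4)
      - (1 / 4) * (8 * (A - 2 * x ^ 2) / (A + 2 * x ^ 2) ^ 2) ^ 2) = 0 := by
  refine integral_eq_zero_of_hasDerivAt_of_abs_le
    (F := fun x => x * (32 / 3 * x ^ 2 - 16 * A) / (A + 2 * x ^ 2) ^ 3)
    (fun x => ?_) (((integrable_peregrine_kinetic_density hA).const_mul _).sub
      ((integrable_peregrine_mass_density_sq hA).const_mul _)) 16 fun x => ?_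
  · have hD : A + 2 * x ^ 2 ≠ 0 := by positivity
    refine (((hasDerivAt_id' x).mul (((hasDerivAt_pow 2 x).const_mul (32 / 3)).sub_const
      (16 * A))).div ((hasDerivAt_add_two_mul_sq A x).pow 3) (pow_ne_zero 3 hD)).congr_deriv ?_
    simp only [Pi.mul_apply, Pi.pow_apply]
    norm_num
    field_simp
    ring
  · have hD : 1 ≤ A + 2 * x ^ 2 := by nlinarith [sq_nonneg x]
    have hD0 : 0 < A + 2 * x ^ 2 := by positivity
    have hN : |32 / 3 * x ^ 2 - 16 * A| ≤ 16 * (A + 2 * x ^ 2) := by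
      rw [abs_le]; constructor <;> nlinarith [sq_nonneg x]
    rw [abs_div, abs_mul, abs_of_pos (pow_pos hD0 3)]
    calc |x| * |32 / 3 * x ^ 2 - 16 * A| / (A + 2 * x ^ 2) ^ 3
        ≤ |x| * (16 * (A + 2 * x ^ 2)) / (A + 2 * x ^ 2) ^ 3 := by gcongr
      _ = 16 * (|x| / (A + 2 * x ^ 2) ^ 2) := by field_simp
      _ ≤ 16 * (|x| / (A + 2 * x ^ 2)) := by
        gcongr
        exact le_self_pow₀ hD two_ne_zero
      _ ≤ 16 * |x⁻¹| := by gcongr; exact abs_div_add_two_mul_sq_le hA x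

lemma norm_exp_I_mul_ofReal_mul_sq (t : ℝ) (z : ℂ) :
    ‖Complex.exp (Complex.I * (t : ℂ)) * z‖ ^ 2 = Complex.normSq z := by
  rw [norm_mul, mul_comm Complex.I, Complex.norm_exp_ofReal_mul_I, one_mul, Complex.sq_norm]

lemma norm_peregrine_sq_sub_one (t x : ℝ) :
    ‖Complex.exp (Complex.I * (t : ℂ)) * (1 - 4 * (1 + 2 * Complex.I * (t : ℂ)) /
      (1 + 4 * (t : ℂ) ^ 2 + 2 * (x : ℂ) ^ 2))‖ ^ 2 - 1
    = 8 * ((1 + 4 * t ^ 2) - 2 * x ^ 2) / ((1 + 4 * t ^ 2) + 2 * x ^ 2) ^ 2 := by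
  have hD : 1 + 4 * t ^ 2 + 2 * x ^ 2 ≠ 0 := by positivity
  have hz : (1 - 4 * (1 + 2 * Complex.I * (t : ℂ)) / (1 + 4 * (t : ℂ) ^ 2 + 2 * (x : ℂ) ^ 2))
      = ((1 - 4 / (1 + 4 * t ^ 2 + 2 * x ^ 2) : ℝ) : ℂ)
        + ((-8 * t / (1 + 4 * t ^ 2 + 2 * x ^ 2) : ℝ) : ℂ) * Complex.I := by
    push_cast
    ring
  rw [norm_exp_I_mul_ofReal_mul_sq, hz, Complex.normSq_add_mul_I]
  field_simp
  ring

lemma norm_deriv_peregrine_sq (t x : ℝ) :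
    ‖deriv (fun x : ℝ => Complex.exp (Complex.I * (t : ℂ)) *
      (1 - 4 * (1 + 2 * Complex.I * (t : ℂ)) / (1 + 4 * (t : ℂ) ^ 2 + 2 * (x : ℂ) ^ 2))) x‖ ^ 2
    = 256 * (1 + 4 * t ^ 2) * x ^ 2 / ((1 + 4 * t ^ 2) + 2 * x ^ 2) ^ 4 := by
  have hD : 1 + 4 * t ^ 2 + 2 * x ^ 2 ≠ 0 := by positivity
  have hinv := ((hasDerivAt_add_two_mul_sq (1 + 4 * t ^ 2) x).inv hD).ofReal_comp
  have hder := (((hinv.const_mul (4 * (1 + 2 * Complex.I * (t : ℂ)))).const_sub 1).const_mul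
    (Complex.exp (Complex.I * (t : ℂ)))).deriv
  have hfun : (fun x : ℝ => Complex.exp (Complex.I * (t : ℂ)) *
      (1 - 4 * (1 + 2 * Complex.I * (t : ℂ)) / (1 + 4 * (t : ℂ) ^ 2 + 2 * (x : ℂ) ^ 2)))
      = fun x : ℝ => Complex.exp (Complex.I * (t : ℂ)) * (1 - 4 * (1 + 2 * Complex.I * (t : ℂ)) *
        (((fun x : ℝ => 1 + 4 * t ^ 2 + 2 * x ^ 2)⁻¹ x : ℝ) : ℂ)) := by
    funext y
    simp only [Pi.inv_apply]
    push_cast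
    rw [div_eq_mul_inv]
  have hz : -(4 * (1 + 2 * Complex.I * (t : ℂ)) *
      ((-(4 * x) / (1 + 4 * t ^ 2 + 2 * x ^ 2) ^ 2 : ℝ) : ℂ))
      = ((16 * x / (1 + 4 * t ^ 2 + 2 * x ^ 2) ^ 2 : ℝ) : ℂ)
        + ((32 * t * x / (1 + 4 * t ^ 2 + 2 * x ^ 2) ^ 2 : ℝ) : ℂ) * Complex.I := by
    push_cast
    ring
  rw [hfun, hder, norm_exp_I_mul_ofReal_mul_sq, hz, Complex.normSq_add_mul_I]
  field_simp
  ring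

theorem peregrine_mass_energy_zero (P : ℝ → ℝ → ℂ)
    (hP : P = fun t x : ℝ =>
      Complex.exp (Complex.I * (t : ℂ)) *
        (1 - 4 * (1 + 2 * Complex.I * (t : ℂ)) /
          (1 + 4 * (t : ℂ) ^ 2 + 2 * (x : ℂ) ^ 2))) :
    ∀ t : ℝ,
      (∫ x : ℝ, (‖P t x‖ ^ 2 - 1)) = 0
      ∧ (1 / 2) * (∫ x : ℝ, ‖deriv (fun x' : ℝ => P t x') x‖ ^ 2)
          - (1 / 4) * (∫ x : ℝ, (‖P t x‖ ^ 2 - 1) ^ 2) = 0 := by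
  intro t
  subst hP
  have hA : 1 ≤ 1 + 4 * t ^ 2 := by nlinarith [sq_nonneg t]
  simp only [norm_peregrine_sq_sub_one, norm_deriv_peregrine_sq]
  refine ⟨integral_peregrine_mass_density hA, ?_⟩
  rw [← integral_const_mul, ← integral_const_mul, ← integral_sub
    ((integrable_peregrine_kinetic_density hA).const_mul _)
    ((integrable_peregrine_mass_density_sq hA).const_mul _)]
  exact integral_peregrine_energy_density hA
end

section
/- Let w : ℝ × ℝ → ℂ be a smooth solution of the linearized equation i·∂ₜw(t, x) + ∂ₓ²w(t, x) + 2·Re w(t, x) = 0 such that for every t the functions x ↦ w(t, x), x ↦ ∂ₜw(t, x) and x ↦ ∂ₓ²w(t, x) are integrable on ℝ, x ↦ ∂ₓw(t, x) tends to 0 as |x| → ∞, and on every compact time interval |∂ₜw(t, x)| is dominated by a t-independent integrable function of x. Then for all t ∈ ℝ: ∫_ℝ Re w(t, x) dx = ∫_ℝ Re w(0, x) dx, and ∫_ℝ Im w(t, x) dx = ∫_ℝ Im w(0, x) dx + 2t·∫_ℝ Re w(0, x) dx. In particular, if ∫_ℝ Re w(0, x) dx ≠ 0, the zero Fourier mode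 of w(t) grows linearly in time. -/
open MeasureTheory Filter

/-- The integral over the line of the second derivative of a `C²` function vanishes when that
derivative is integrable and the first derivative decays at infinity. -/
lemma integral_deriv_deriv_eq_zero {f : ℝ → ℂ} (hf : ContDiff ℝ 2 f)
    (hint : Integrable (deriv (deriv f))) (hdecay : Tendsto (deriv f) (cocompact ℝ) (nhds 0)) :
    ∫ x, deriv (deriv f) x = 0 := by
  have hd : Differentiable ℝ (deriv f) :=
    (contDiff_succ_iff_deriv.1 (show ContDiff ℝ (1 + 1) f by
      simpa [one_add_one_eq_two] using hf)).2.2.differentiable one_ne_zero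
  simpa using integral_of_hasDerivAt_of_tendsto (fun x => (hd x).hasDerivAt) hint
    (hdecay.mono_left atBot_le_cocompact) (hdecay.mono_left atTop_le_cocompact)

/-- Differentiation under the integral sign on the line, with a domination of the time derivative
on compact time intervals. -/
lemma hasDerivAt_integral_of_dominated_on_Icc {w : ℝ → ℝ → ℂ}
    (hdiff : ∀ x, Differentiable ℝ (fun t => w t x))
    (hw_int : ∀ t, Integrable (w t))
    (hwt_int : ∀ t, Integrable (fun x => deriv (fun t' => w t' x) t))
    (hdom : ∀ a b : ℝ, a ≤ b → ∃ g : ℝ → ℝ, Integrable g ∧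
      ∀ t ∈ Set.Icc a b, ∀ x : ℝ, ‖deriv (fun t' : ℝ => w t' x) t‖ ≤ g x) (t : ℝ) :
    HasDerivAt (fun s => ∫ x, w s x) (∫ x, deriv (fun t' => w t' x) t) t := by
  obtain ⟨g, hg, hbound⟩ := hdom (t - 1) (t + 1) (by linarith)
  exact (hasDerivAt_integral_of_dominated_loc_of_deriv_le
    (F' := fun s x => deriv (fun t' => w t' x) s)
    (Icc_mem_nhds (by linarith) (by linarith))
    (Eventually.of_forall fun s => (hw_int s).aestronglyMeasurable) (hw_int t)
    (hwt_int t).aestronglyMeasurable (Eventually.of_forall fun x s hs => hbound s hs x) hg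
    (Eventually.of_forall fun x s _ => (hdiff x s).hasDerivAt)).2

/-- Solutions of the ordinary differential equation `M' = 2 i Re M`. -/
lemma re_im_of_hasDerivAt_two_mul_I_mul_re {M : ℝ → ℂ}
    (hM : ∀ t, HasDerivAt M (2 * Complex.I * ((M t).re : ℂ)) t) (t : ℝ) :
    (M t).re = (M 0).re ∧ (M t).im = (M 0).im + 2 * t * (M 0).re := by
  have hre_deriv : ∀ s, HasDerivAt (fun s => (M s).re) 0 s := fun s => by
    simpa [Function.comp_def] using Complex.reCLM.hasFDerivAt.comp_hasDerivAt s (hM s)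
  have hre : ∀ s, (M s).re = (M 0).re := fun s =>
    is_const_of_deriv_eq_zero (fun r => (hre_deriv r).differentiableAt)
      (fun r => (hre_deriv r).deriv) s 0
  have him_deriv : ∀ s, HasDerivAt (fun s => (M s).im) (2 * (M 0).re) s := fun s => by
    simpa [Function.comp_def, hre s] using Complex.imCLM.hasFDerivAt.comp_hasDerivAt s (hM s)
  have hsub : ∀ s, HasDerivAt (fun s => (M s).im - s * (2 * (M 0).re)) 0 s := fun s => by
    simpa using (him_deriv s).fun_sub ((hasDerivAt_id s).mul_const (2 * (M 0).re))
  have him := is_const_of_deriv_eq_zero (fun r => (hsub r).differentiableAt)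
    (fun r => (hsub r).deriv) t 0
  exact ⟨hre t, by linarith⟩

theorem zero_mode_linear_growth (w : ℝ → ℝ → ℂ)
    (hsmooth : ContDiff ℝ (⊤ : ℕ∞) (fun p : ℝ × ℝ => w p.1 p.2))
    (heq : ∀ t x : ℝ,
      Complex.I * deriv (fun t' : ℝ => w t' x) t
      + deriv (deriv (fun x' : ℝ => w t x')) x
      + 2 * (((w t x).re : ℂ)) = 0)
    (hw_int : ∀ t : ℝ, Integrable (fun x : ℝ => w t x))
    (hwt_int : ∀ t : ℝ, Integrable (fun x : ℝ => deriv (fun t' : ℝ => w t' x) t))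
    (hwxx_int : ∀ t : ℝ, Integrable (fun x : ℝ => deriv (deriv (fun x' : ℝ => w t x')) x))
    (hwx_decay : ∀ t : ℝ,
      Tendsto (fun x : ℝ => deriv (fun x' : ℝ => w t x') x) (cocompact ℝ) (nhds 0))
    (hdom : ∀ a b : ℝ, a ≤ b → ∃ g : ℝ → ℝ, Integrable g ∧
      ∀ t ∈ Set.Icc a b, ∀ x : ℝ, ‖deriv (fun t' : ℝ => w t' x) t‖ ≤ g x) :
    ∀ t : ℝ,
      (∫ x : ℝ, (w t x).re) = (∫ x : ℝ, (w 0 x).re)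
      ∧ (∫ x : ℝ, (w t x).im)
          = (∫ x : ℝ, (w 0 x).im) + 2 * t * ∫ x : ℝ, (w 0 x).re := by
  have htime : ∀ x, Differentiable ℝ (fun t => w t x) := fun x =>
    (hsmooth.comp (contDiff_id.prodMk contDiff_const)).differentiable (by simp)
  have hspace : ∀ t, ContDiff ℝ 2 (fun x => w t x) := fun t =>
    contDiff_infty.1 (hsmooth.comp (contDiff_const.prodMk contDiff_id)) 2
  have hre : ∀ t, ∫ x, (w t x).re = (∫ x, w t x).re := fun t => integral_re (hw_int t)
  have him : ∀ t, ∫ x, (w t x).im = (∫ x, w t x).im := fun t => integral_im (hw_int t)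
  have hode : ∀ t, HasDerivAt (fun s => ∫ x, w s x)
      (2 * Complex.I * ((∫ x, w t x).re : ℂ)) t := by
    intro t
    convert hasDerivAt_integral_of_dominated_on_Icc htime hw_int hwt_int hdom t using 1
    have hwt : ∀ x, deriv (fun t' => w t' x) t =
        Complex.I * deriv (deriv (fun x' => w t x')) x
          + 2 * Complex.I * ((w t x).re : ℂ) := fun x => by
      linear_combination (-Complex.I) * heq t x
        + deriv (fun t' => w t' x) t * Complex.I_sq
    have hre_int : Integrable (fun x => ((w t x).re : ℂ)) := (hw_int t).re.ofReal
    simp_rw [hwt]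
    rw [integral_add ((hwxx_int t).const_mul _) (hre_int.const_mul _), integral_const_mul,
      integral_const_mul, integral_deriv_deriv_eq_zero (hspace t) (hwxx_int t) (hwx_decay t),
      integral_complex_ofReal, hre t, mul_zero, zero_add]
  intro t
  simp only [hre, him]
  exact re_im_of_hasDerivAt_two_mul_I_mul_re hode t
end
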